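/- arXiv:1003.4973 — 5 statements merged into one kernel-verified Lean document; each statement's English description precedes it below -/
import Mathlib

section
/- Let n ∈ ℕ, a, A ∈ ℝ and δ ∈ (0, π/(2n)]. Suppose K ∈ L₁ satisfies K(t) = A almost everywhere on (−π+a, π+a) ∖ (a−δ, a+δ), and either K(t) ≥ A almost everywhere on (a−δ, a+δ) or K(t) ≤ A almost everywhere on (a−δ, a+δ). Then K satisfies condition B_n^* with n* = n, T* ≡ A and φ*(t) = ±sign(cos n(t−a)), and consequently E_n(K)₁ = ‖K − A‖₁. -/
open MeasureTheory Real Set Filter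
open scoped ENNReal

/-- The `L_p` norm (p = 1 or p = ∞) of a `2π`-periodic function, computed on `(-π, π]`. -/
noncomputable def Lnorm (p : ℝ≥0∞) (f : ℝ → ℝ) : ℝ :=
  if p = ⊤ then essSup (fun t => |f t|) (volume.restrict (Ioc (-π) π))
  else (∫ t in (-π)..π, |f t| ^ p.toReal) ^ (1 / p.toReal)

/-- A trigonometric polynomial of the class `T_n` (degree at most `n - 1`). -/
def IsTrigPoly (n : ℕ) (T : ℝ → ℝ) : Prop :=
  ∃ a b : ℕ → ℝ, ∀ t, T t = a 0 / 2 + ∑ k ∈ Finset.Icc 1 (n - 1),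
    (a k * Real.cos (k * t) + b k * Real.sin (k * t))

/-- `E_n(f)₁`: best `L₁` approximation by trigonometric polynomials from `T_n`. -/
noncomputable def bestApprox (n : ℕ) (f : ℝ → ℝ) : ℝ :=
  sInf {y | ∃ T, IsTrigPoly n T ∧ y = Lnorm 1 (fun t => f t - T t)}

/-- Cosine Fourier coefficient `μ_k`. -/
noncomputable def cosCoeff (f : ℝ → ℝ) (k : ℕ) : ℝ :=
  (1 / π) * ∫ t in (-π)..π, f t * Real.cos (k * t)

/-- Sine Fourier coefficient `λ_k`. -/
noncomputable def sinCoeff (f : ℝ → ℝ) (k : ℕ) : ℝ :=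
  (1 / π) * ∫ t in (-π)..π, f t * Real.sin (k * t)

/-- Membership in `L₁(-π,π)`: `2π`-periodic and integrable on `(-π,π)`. -/
def MemL1 (f : ℝ → ℝ) : Prop :=
  Function.Periodic f (2 * π) ∧ IntervalIntegrable f volume (-π) π

/-- Convolution `(φ * K)(x) = (1/2π) ∫ φ(x - t) K(t) dt`. -/
noncomputable def conv (φ K : ℝ → ℝ) (x : ℝ) : ℝ :=
  (1 / (2 * π)) * ∫ t in (-π)..π, φ (x - t) * K t

/-- The class `H_p^n`. -/
def Hclass (p : ℝ≥0∞) (n : ℕ) (φ : ℝ → ℝ) : Prop :=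
  MemL1 φ ∧ Lnorm p φ ≤ 1 ∧ ∀ k : ℕ, k < n → cosCoeff φ k = 0 ∧ sinCoeff φ k = 0

/-- The class `W_{p,n}(K)` of convolutions `φ * K`, `φ ∈ H_p^n`. -/
def Wclass (p : ℝ≥0∞) (n : ℕ) (K : ℝ → ℝ) : Set (ℝ → ℝ) :=
  {f | ∃ φ, Hclass p n φ ∧ f = conv φ K}

/-- `sup_{f ∈ W} ‖f‖_p`. -/
noncomputable def supNorm (p : ℝ≥0∞) (W : Set (ℝ → ℝ)) : ℝ :=
  sSup {y | ∃ f ∈ W, y = Lnorm p f}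

/-- Condition `B_n^*` with explicit `n*`. -/
def CondBnWith (n nstar : ℕ) (K Tstar φstar : ℝ → ℝ) : Prop :=
  IsTrigPoly n Tstar ∧ n ≤ nstar ∧ 0 < nstar ∧
    (∀ᵐ t : ℝ ∂volume, |φstar t| ≤ 1) ∧
    (∀ᵐ t : ℝ ∂volume, φstar t * (K t - Tstar t) = |K t - Tstar t|) ∧
    (∀ᵐ t : ℝ ∂volume, φstar (t + π / nstar) = -φstar t)

/-- Condition `B_n^*`. -/
def CondBn (n : ℕ) (K Tstar φstar : ℝ → ℝ) : Prop :=
  ∃ nstar, CondBnWith n nstar K Tstar φstar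

/-- A `c`-periodic property holding almost everywhere on one period holds almost everywhere. -/
lemma ae_of_ae_restrict_Ioo_of_periodic {P : ℝ → Prop} {c : ℝ} (hc : 0 < c) (x : ℝ)
    (hP : Function.Periodic P c) (h : ∀ᵐ t ∂volume.restrict (Ioo x (x + c)), P t) :
    ∀ᵐ t : ℝ, P t := by
  rw [Measure.restrict_congr_set Ioo_ae_eq_Ioc, ae_restrict_iff' measurableSet_Ioc] at h
  have hshift : ∀ᵐ t : ℝ, ∀ m : ℤ, t + m • c ∈ Ioc x (x + c) → P (t + m • c) :=
    ae_all_iff.2 fun m =>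
      (measurePreserving_add_right volume (m • c)).quasiMeasurePreserving.ae h
  filter_upwards [hshift] with t ht
  obtain ⟨m, hm, -⟩ := existsUnique_add_zsmul_mem_Ioc hc t x
  exact (hP.zsmul m t) ▸ ht m hm

lemma measurable_real_sign : Measurable Real.sign :=
  Measurable.ite measurableSet_Iio measurable_const
    (Measurable.ite measurableSet_Ioi measurable_const measurable_const)

lemma abs_real_sign_le_one (x : ℝ) : |Real.sign x| ≤ 1 := by
  rcases Real.sign_apply_eq x with h | h | h <;> simp [h]

lemma Lnorm_one (f : ℝ → ℝ) : Lnorm 1 f = ∫ t in (-π)..π, |f t| := by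
  simp [Lnorm]

lemma IsTrigPoly.const (n : ℕ) (A : ℝ) : IsTrigPoly n fun _ => A :=
  ⟨fun k => if k = 0 then 2 * A else 0, 0, fun t => by
    rw [Finset.sum_eq_zero]
    · simp
    · intro k hk
      have : k ≠ 0 := by have := Finset.mem_Icc.1 hk; omega
      simp [this]⟩

lemma IsTrigPoly.continuous {n : ℕ} {T : ℝ → ℝ} (hT : IsTrigPoly n T) : Continuous T := by
  obtain ⟨a, b, h⟩ := hT
  rw [funext h]
  fun_prop

/-- A bounded measurable function times an integrable function is integrable. -/
lemma IntervalIntegrable.bdd_mul_of_measurable {φ g : ℝ → ℝ} {x y : ℝ} (hφm : Measurable φ)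
    (hφ : ∀ t, |φ t| ≤ 1) (hg : IntervalIntegrable g volume x y) :
    IntervalIntegrable (fun t => φ t * g t) volume x y := by
  rw [intervalIntegrable_iff] at hg ⊢
  exact hg.bdd_mul hφm.aestronglyMeasurable (Eventually.of_forall hφ)

/-- A `2π`-periodic function with `φ (t + π / n) = -φ t` is orthogonal to the harmonics of
order less than `n`. -/
lemma integral_mul_cos_sin_eq_zero_of_antiperiodic {φ : ℝ → ℝ} {n k : ℕ} (hk : k < n)
    (hφm : Measurable φ) (hφ : ∀ t, |φ t| ≤ 1) (hper : Function.Periodic φ (2 * π))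
    (hanti : ∀ t, φ (t + π / n) = -φ t) :
    (∫ t in (-π)..π, φ t * Real.cos (k * t)) = 0 ∧
      (∫ t in (-π)..π, φ t * Real.sin (k * t)) = 0 := by
  have hn : (0 : ℝ) < n := by exact_mod_cast (Nat.zero_le k).trans_lt hk
  set h : ℝ := π / n with h_def
  have hcos : IntervalIntegrable (fun t => φ t * Real.cos (k * t)) volume (-π) π :=
    IntervalIntegrable.bdd_mul_of_measurable hφm hφ
      (Continuous.intervalIntegrable (by fun_prop) _ _)
  have hsin : IntervalIntegrable (fun t => φ t * Real.sin (k * t)) volume (-π) π :=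
    IntervalIntegrable.bdd_mul_of_measurable hφm hφ
      (Continuous.intervalIntegrable (by fun_prop) _ _)
  have shift : ∀ f : ℝ → ℝ, Function.Periodic f (2 * π) →
      ∫ t in (-π)..π, f (t + h) = ∫ t in (-π)..π, f t := by
    intro f hf
    rw [intervalIntegral.integral_comp_add_right]
    have := hf.intervalIntegral_add_eq (-π + h) (-π)
    convert this using 2 <;> ring
  have pcos : Function.Periodic (fun t => φ t * Real.cos (k * t)) (2 * π) := fun t => by
    simp only [hper t, mul_add, Real.cos_add_nat_mul_two_pi]
  have psin : Function.Periodic (fun t => φ t * Real.sin (k * t)) (2 * π) := fun t => by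
    simp only [hper t, mul_add, Real.sin_add_nat_mul_two_pi]
  have ec := shift _ pcos
  have es := shift _ psin
  set I := ∫ t in (-π)..π, φ t * Real.cos (k * t)
  set J := ∫ t in (-π)..π, φ t * Real.sin (k * t)
  set c := Real.cos (k * h)
  set s := Real.sin (k * h)
  have ec' : s * J - c * I = I := by
    refine Eq.trans ?_ ec
    rw [← intervalIntegral.integral_const_mul, ← intervalIntegral.integral_const_mul,
      ← intervalIntegral.integral_sub (hsin.const_mul _) (hcos.const_mul _)]
    congr 1
    ext t
    rw [hanti, mul_add, Real.cos_add]
    ring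
  have es' : -s * I - c * J = J := by
    refine Eq.trans ?_ es
    rw [← intervalIntegral.integral_const_mul, ← intervalIntegral.integral_const_mul,
      ← intervalIntegral.integral_sub (hcos.const_mul _) (hsin.const_mul _)]
    congr 1
    ext t
    rw [hanti, mul_add, Real.sin_add]
    ring
  have hkh : (k : ℝ) * h < π := by
    have : (k : ℝ) < n := by exact_mod_cast hk
    rw [h_def, mul_div_assoc', div_lt_iff₀ hn, mul_comm]
    exact mul_lt_mul_of_pos_left this Real.pi_pos
  have hc : -1 < c := by
    rw [← Real.cos_pi]
    exact Real.cos_lt_cos_of_nonneg_of_le_pi (by positivity) le_rfl hkh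
  have hpos : (1 + c) ^ 2 + s ^ 2 ≠ 0 := by
    have : 0 < 1 + c := by linarith
    positivity
  constructor
  · refine (mul_eq_zero.1 (?_ : ((1 + c) ^ 2 + s ^ 2) * I = 0)).resolve_left hpos
    linear_combination -(1 + c) * ec' - s * es'
  · refine (mul_eq_zero.1 (?_ : ((1 + c) ^ 2 + s ^ 2) * J = 0)).resolve_left hpos
    linear_combination -(1 + c) * es' + s * ec'

lemma IsTrigPoly.integral_mul_eq_zero_of_antiperiodic {φ T : ℝ → ℝ} {n : ℕ} (hn : 0 < n)
    (hT : IsTrigPoly n T) (hφm : Measurable φ) (hφ : ∀ t, |φ t| ≤ 1)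
    (hper : Function.Periodic φ (2 * π)) (hanti : ∀ t, φ (t + π / n) = -φ t) :
    ∫ t in (-π)..π, φ t * T t = 0 := by
  obtain ⟨a, b, h⟩ := hT
  have key := fun k (hk : k < n) =>
    integral_mul_cos_sin_eq_zero_of_antiperiodic hk hφm hφ hper hanti
  have hint : ∀ g : ℝ → ℝ, Continuous g →
      IntervalIntegrable (fun t => φ t * g t) volume (-π) π := fun g hg =>
    IntervalIntegrable.bdd_mul_of_measurable hφm hφ (hg.intervalIntegrable _ _)
  have hzero : ∫ t in (-π)..π, φ t * (a 0 / 2) = 0 := by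
    have := (key 0 hn).1
    simp only [Nat.cast_zero, zero_mul, Real.cos_zero, mul_one] at this
    rw [intervalIntegral.integral_mul_const, this, zero_mul]
  simp_rw [h, mul_add, Finset.mul_sum]
  rw [intervalIntegral.integral_add (hint _ continuous_const), hzero, zero_add,
    intervalIntegral.integral_finsetSum]
  · refine Finset.sum_eq_zero fun k hk => ?_
    have hkn : k < n := by have := Finset.mem_Icc.1 hk; omega
    have e : ∀ t, φ t * (a k * Real.cos (k * t) + b k * Real.sin (k * t)) =
        a k * (φ t * Real.cos (k * t)) + b k * (φ t * Real.sin (k * t)) := fun t => by ring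
    simp_rw [e]
    rw [intervalIntegral.integral_add ((hint _ (by fun_prop)).const_mul _)
      ((hint _ (by fun_prop)).const_mul _), intervalIntegral.integral_const_mul,
      intervalIntegral.integral_const_mul, (key k hkn).1, (key k hkn).2]
    simp
  · exact fun k _ => hint _ (by fun_prop)
  · simp_rw [← Finset.mul_sum]
    exact hint _ (by fun_prop)

/-- A sign function of `K - T₀` which is `π / n`-antiperiodic certifies that `T₀` is a best
`L₁` approximation of `K` from `T_n`. -/
lemma bestApprox_eq_of_antiperiodic {n : ℕ} (hn : 0 < n) {K T₀ φ : ℝ → ℝ}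
    (hK : IntervalIntegrable K volume (-π) π) (hT₀ : IsTrigPoly n T₀) (hφm : Measurable φ)
    (hφ : ∀ t, |φ t| ≤ 1) (hper : Function.Periodic φ (2 * π))
    (hanti : ∀ t, φ (t + π / n) = -φ t)
    (hsign : ∀ᵐ t : ℝ, φ t * (K t - T₀ t) = |K t - T₀ t|) :
    bestApprox n K = Lnorm 1 fun t => K t - T₀ t := by
  refine IsLeast.csInf_eq ⟨⟨T₀, hT₀, rfl⟩, ?_⟩
  rintro _ ⟨T, hT, rfl⟩
  have hpi : -π ≤ π := by linarith [Real.pi_pos]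
  have hTi := hT.continuous.intervalIntegrable (μ := volume) (-π) π
  have hmul : ∀ {g : ℝ → ℝ}, IntervalIntegrable g volume (-π) π →
      IntervalIntegrable (fun t => φ t * g t) volume (-π) π :=
    fun hg => IntervalIntegrable.bdd_mul_of_measurable hφm hφ hg
  have hsub : ∀ {S : ℝ → ℝ}, IsTrigPoly n S →
      ∫ t in (-π)..π, φ t * (K t - S t) = ∫ t in (-π)..π, φ t * K t := by
    intro S hS
    simp_rw [mul_sub]
    rw [intervalIntegral.integral_sub (hmul hK)
      (hmul (hS.continuous.intervalIntegrable _ _)),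
      hS.integral_mul_eq_zero_of_antiperiodic hn hφm hφ hper hanti, sub_zero]
  rw [Lnorm_one, Lnorm_one]
  calc ∫ t in (-π)..π, |K t - T₀ t| = ∫ t in (-π)..π, φ t * (K t - T₀ t) :=
        intervalIntegral.integral_congr_ae (hsign.mono fun t ht _ => ht.symm)
    _ = ∫ t in (-π)..π, φ t * (K t - T t) := by rw [hsub hT₀, hsub hT]
    _ ≤ ∫ t in (-π)..π, |K t - T t| := by
        refine intervalIntegral.integral_mono_on hpi (hmul (hK.sub hTi)) (hK.sub hTi).abs
          fun t _ => (le_abs_self _).trans ?_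
        rw [abs_mul]
        exact mul_le_of_le_one_left (abs_nonneg _) (hφ t)

/-- A kernel which is a.e. constant outside a small bump satisfies `B_n^*` and
its best approximation is attained at the constant. -/
theorem condBn_of_bump
    (n : ℕ) (hn : 0 < n) (a A δ : ℝ) (hδ : 0 < δ) (hδle : δ ≤ π / (2 * n))
    (K : ℝ → ℝ) (hK : MemL1 K)
    (hflat : ∀ᵐ t ∂(volume.restrict ((Ioo (-π + a) (π + a)) \ (Ioo (a - δ) (a + δ)))),
      K t = A)
    (hbump : (∀ᵐ t ∂(volume.restrict (Ioo (a - δ) (a + δ))), A ≤ K t) ∨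
             (∀ᵐ t ∂(volume.restrict (Ioo (a - δ) (a + δ))), K t ≤ A)) :
    (∃ ε : ℝ, (ε = 1 ∨ ε = -1) ∧
      CondBnWith n n K (fun _ => A) (fun t => ε * Real.sign (Real.cos (n * (t - a))))) ∧
    bestApprox n K = Lnorm 1 (fun t => K t - A) := by
  have hnR : (0 : ℝ) < n := by exact_mod_cast hn
  set ψ : ℝ → ℝ := fun t => Real.sign (Real.cos (n * (t - a))) with hψ
  have hψm : Measurable ψ := measurable_real_sign.comp (by fun_prop)
  have hψper : Function.Periodic ψ (2 * π) := fun t => by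
    have e : (n : ℝ) * (t + 2 * π - a) = n * (t - a) + n * (2 * π) := by ring
    simp only [hψ, e, Real.cos_add_nat_mul_two_pi]
  have hψanti : ∀ t, ψ (t + π / n) = -ψ t := fun t => by
    have e : (n : ℝ) * (t + π / n - a) = n * (t - a) + π := by field_simp; ring
    simp only [hψ, e, Real.cos_add_pi, Real.sign_neg]
  have hψone : ∀ t ∈ Ioo (a - δ) (a + δ), ψ t = 1 := by
    rintro t ⟨h1, h2⟩
    have hb : (n : ℝ) * δ ≤ π / 2 := by
      calc (n : ℝ) * δ ≤ n * (π / (2 * n)) := by gcongr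
        _ = π / 2 := by field_simp
    refine Real.sign_of_pos (Real.cos_pos_of_mem_Ioo ⟨?_, ?_⟩)
    · have := mul_lt_mul_of_pos_left (show -δ < t - a by linarith) hnR
      linarith
    · have := mul_lt_mul_of_pos_left (show t - a < δ by linarith) hnR
      linarith
  obtain ⟨ε, hε, hbump'⟩ : ∃ ε : ℝ, (ε = 1 ∨ ε = -1) ∧
      ∀ᵐ t ∂(volume.restrict (Ioo (a - δ) (a + δ))), ε * (K t - A) = |K t - A| := by
    rcases hbump with h | h
    · refine ⟨1, Or.inl rfl, h.mono fun t ht => ?_⟩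
      rw [abs_of_nonneg (sub_nonneg.2 ht), one_mul]
    · refine ⟨-1, Or.inr rfl, h.mono fun t ht => ?_⟩
      rw [abs_of_nonpos (sub_nonpos.2 ht), neg_one_mul]
  have hle : ∀ t, |ε * ψ t| ≤ 1 := fun t => by
    have h : |ε| = 1 := by rcases hε with rfl | rfl <;> simp
    rw [abs_mul, h, one_mul]
    exact abs_real_sign_le_one _
  have hper : Function.Periodic (fun t => ε * ψ t) (2 * π) := fun t => by
    simp only [hψper t]
  have hanti : ∀ t, ε * ψ (t + π / n) = -(ε * ψ t) := fun t => by
    rw [hψanti, mul_neg]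
  have hsign : ∀ᵐ t : ℝ, ε * ψ t * (K t - A) = |K t - A| := by
    refine ae_of_ae_restrict_Ioo_of_periodic Real.two_pi_pos (-π + a)
      (fun t => by simp only [hψper t, hK.1 t]) ?_
    rw [show -π + a + 2 * π = π + a by ring, ae_restrict_iff' measurableSet_Ioo]
    rw [ae_restrict_iff' (measurableSet_Ioo.diff measurableSet_Ioo)] at hflat
    rw [ae_restrict_iff' measurableSet_Ioo] at hbump'
    filter_upwards [hflat, hbump'] with t h1 h2 ht
    by_cases hmem : t ∈ Ioo (a - δ) (a + δ)
    · rw [hψone t hmem, mul_one]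
      exact h2 hmem
    · simp [h1 ⟨ht, hmem⟩]
  exact ⟨⟨ε, hε, .const n A, le_rfl, hn, .of_forall hle, hsign, .of_forall hanti⟩,
    bestApprox_eq_of_antiperiodic hn hK.2 (.const n A) (hψm.const_mul ε) hle hper hanti hsign⟩
end

section
/- Let K ∈ L₁ have Fourier series μ₀/2 + Σ_{k=1}^∞ (μ_k cos kt + λ_k sin kt). Then for every n ∈ ℕ both series Σ_{k=0}^∞ λ_{(2k+1)n}/(2k+1) and Σ_{k=0}^∞ (−1)^k μ_{(2k+1)n}/(2k+1) converge. -/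
open MeasureTheory Real Set Filter
open scoped ENNReal

/-- `S` is the sum of the series `Σ a k` (limit of partial sums). -/
def SeriesSum (a : ℕ → ℝ) (S : ℝ) : Prop :=
  Tendsto (fun N => ∑ k ∈ Finset.range N, a k) atTop (nhds S)

/-- Abel's inequality: weighting a series with bounded partial sums by nonnegative antitone
coefficients. -/
theorem abs_sum_mul_le_of_antitone {b c : ℕ → ℝ} {B : ℝ} (hc : Antitone c) (hc0 : ∀ k, 0 ≤ c k)
    (hb : ∀ N, |∑ k ∈ Finset.range N, b k| ≤ B) (N : ℕ) :
    |∑ k ∈ Finset.range N, c k * b k| ≤ B * c 0 := by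
  have key : |∑ k ∈ Finset.range N, c k * b k - c N * ∑ k ∈ Finset.range N, b k|
      ≤ B * (c 0 - c N) := by
    induction N with
    | zero => simp
    | succ N ih =>
      have hstep : ∑ k ∈ Finset.range (N + 1), c k * b k
            - c (N + 1) * ∑ k ∈ Finset.range (N + 1), b k
          = (∑ k ∈ Finset.range N, c k * b k - c N * ∑ k ∈ Finset.range N, b k)
            + (c N - c (N + 1)) * ∑ k ∈ Finset.range (N + 1), b k := by
        rw [Finset.sum_range_succ, Finset.sum_range_succ]
        ring
      have hd : 0 ≤ c N - c (N + 1) := sub_nonneg.2 (hc N.le_succ)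
      have hmul : |(c N - c (N + 1)) * ∑ k ∈ Finset.range (N + 1), b k|
          ≤ (c N - c (N + 1)) * B := by
        rw [abs_mul, abs_of_nonneg hd]
        exact mul_le_mul_of_nonneg_left (hb _) hd
      rw [hstep]
      refine (abs_add_le _ _).trans ?_
      linarith
  have hlast : |c N * ∑ k ∈ Finset.range N, b k| ≤ c N * B := by
    rw [abs_mul, abs_of_nonneg (hc0 N)]
    exact mul_le_mul_of_nonneg_left (hb N) (hc0 N)
  have htri := abs_add_le (∑ k ∈ Finset.range N, c k * b k - c N * ∑ k ∈ Finset.range N, b k)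
    (c N * ∑ k ∈ Finset.range N, b k)
  rw [sub_add_cancel] at htri
  linarith

theorem sin_mul_sum_sin_odd (x : ℝ) (N : ℕ) :
    Real.sin x * ∑ k ∈ Finset.range N, Real.sin ((2 * (k : ℝ) + 1) * x)
      = Real.sin (N * x) ^ 2 := by
  induction N with
  | zero => simp
  | succ N ih =>
    rw [Finset.sum_range_succ, mul_add, ih]
    have h₁ : (2 * (N : ℝ) + 1) * x = N * x + (N * x + x) := by ring
    have h₂ : ((N + 1 : ℕ) : ℝ) * x = N * x + x := by push_cast; ring
    rw [h₁, h₂, Real.sin_add (N * x) (N * x + x), Real.sin_add (N * x) x, Real.cos_add]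
    linear_combination (-(Real.sin (N * x)) ^ 2) * Real.sin_sq_add_cos_sq x

theorem abs_sin_natCast_mul_le (x : ℝ) (n : ℕ) : |Real.sin (n * x)| ≤ n * |Real.sin x| := by
  induction n with
  | zero => simp
  | succ n ih =>
    have h : ((n + 1 : ℕ) : ℝ) * x = n * x + x := by push_cast; ring
    rw [h, Real.sin_add]
    refine (abs_add_le _ _).trans ?_
    rw [abs_mul, abs_mul]
    have h₁ := mul_le_of_le_one_right (abs_nonneg (Real.sin (n * x))) (Real.abs_cos_le_one x)
    have h₂ := mul_le_of_le_one_left (abs_nonneg (Real.sin x)) (Real.abs_cos_le_one (n * x))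
    push_cast
    linarith

theorem sin_odd_mul_eq_zero {x : ℝ} (hx : Real.sin x = 0) (k : ℕ) :
    Real.sin ((2 * (k : ℝ) + 1) * x) = 0 := by
  have h := abs_sin_natCast_mul_le x (2 * k + 1)
  rw [hx, abs_zero, mul_zero] at h
  simpa using h

theorem abs_sum_sin_odd_shift_le {x : ℝ} (hx : Real.sin x ≠ 0) (m N : ℕ) :
    |∑ k ∈ Finset.range N, Real.sin ((2 * ((m + k : ℕ) : ℝ) + 1) * x)| ≤ 1 / |Real.sin x| := by
  rw [le_div_iff₀ (abs_pos.2 hx), ← abs_mul, mul_comm]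
  have h := sin_mul_sum_sin_odd x (m + N)
  rw [Finset.sum_range_add, mul_add, sin_mul_sum_sin_odd] at h
  rw [eq_sub_of_add_eq' h, abs_le]
  constructor <;>
  nlinarith [Real.sin_sq_le_one (m * x), Real.sin_sq_le_one ((m + N : ℕ) * x),
    sq_nonneg (Real.sin (m * x)), sq_nonneg (Real.sin ((m + N : ℕ) * x))]

theorem antitone_inv_odd (m : ℕ) : Antitone fun k : ℕ => (2 * ((m + k : ℕ) : ℝ) + 1)⁻¹ := by
  intro i j hij
  have : (i : ℝ) ≤ j := by exact_mod_cast hij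
  dsimp only
  gcongr

/-- Partial sums of the sine series of the square wave. -/
noncomputable def squareWaveSum (N : ℕ) (x : ℝ) : ℝ :=
  ∑ k ∈ Finset.range N, (2 * (k : ℝ) + 1)⁻¹ * Real.sin ((2 * (k : ℝ) + 1) * x)

theorem continuous_squareWaveSum (N : ℕ) : Continuous (squareWaveSum N) := by
  unfold squareWaveSum
  fun_prop

theorem abs_squareWaveSum_le_mul (N : ℕ) (x : ℝ) : |squareWaveSum N x| ≤ N * |Real.sin x| := by
  refine (Finset.abs_sum_le_sum_abs _ _).trans ?_
  refine (Finset.sum_le_card_nsmul _ _ |Real.sin x| fun k _ => ?_).trans (by simp)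
  have hk : (0 : ℝ) < 2 * k + 1 := by positivity
  rw [abs_mul, abs_of_pos (inv_pos.2 hk), inv_mul_le_iff₀ hk]
  have h := abs_sin_natCast_mul_le x (2 * k + 1)
  push_cast at h
  exact h

theorem abs_squareWaveSum_le (N : ℕ) (x : ℝ) : |squareWaveSum N x| ≤ 3 := by
  have hsmall := abs_squareWaveSum_le_mul N x
  by_cases hx : Real.sin x = 0
  · rw [hx, abs_zero, mul_zero] at hsmall
    linarith
  have hpos : 0 < |Real.sin x| := abs_pos.2 hx
  have hone : |Real.sin x| ≤ 1 := Real.abs_sin_le_one x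
  set m := ⌈1 / |Real.sin x|⌉₊ with hm
  have hm_ge : 1 ≤ m * |Real.sin x| := (div_le_iff₀ hpos).1 (Nat.le_ceil _)
  have hm_le : m * |Real.sin x| ≤ 2 := by
    have h := mul_le_mul_of_nonneg_right
      (Nat.ceil_lt_add_one (by positivity : 0 ≤ 1 / |Real.sin x|)).le hpos.le
    rw [add_mul, one_div_mul_cancel hpos.ne', ← hm] at h
    linarith
  rcases le_total N m with hNm | hmN
  · have : (N : ℝ) * |Real.sin x| ≤ m * |Real.sin x| := by gcongr
    linarith
  obtain ⟨j, rfl⟩ := Nat.exists_eq_add_of_le hmN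
  have htail := abs_sum_mul_le_of_antitone (antitone_inv_odd m) (fun k => by positivity)
    (abs_sum_sin_odd_shift_le hx m) j
  have hbound : 1 / |Real.sin x| * (2 * ((m + 0 : ℕ) : ℝ) + 1)⁻¹ ≤ 1 := by
    rw [← div_eq_mul_inv, div_div, div_le_one (by positivity)]
    push_cast
    nlinarith
  have hhead := abs_squareWaveSum_le_mul m x
  have hsplit : squareWaveSum (m + j) x = squareWaveSum m x
      + ∑ k ∈ Finset.range j, (2 * ((m + k : ℕ) : ℝ) + 1)⁻¹
        * Real.sin ((2 * ((m + k : ℕ) : ℝ) + 1) * x) :=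
    Finset.sum_range_add _ _ _
  rw [hsplit]
  refine (abs_add_le _ _).trans ?_
  linarith

theorem exists_tendsto_squareWaveSum (x : ℝ) :
    ∃ S, Tendsto (fun N => squareWaveSum N x) atTop (nhds S) := by
  by_cases hx : Real.sin x = 0
  · exact ⟨0, by simp [squareWaveSum, sin_odd_mul_eq_zero hx]⟩
  have hanti : Antitone fun k : ℕ => (2 * (k : ℝ) + 1)⁻¹ := by simpa using antitone_inv_odd 0
  have hlim : Tendsto (fun k : ℕ => (2 * (k : ℝ) + 1)⁻¹) atTop (nhds 0) :=
    tendsto_inv_atTop_zero.comp <| tendsto_atTop_add_const_right _ _ <|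
      tendsto_natCast_atTop_atTop.const_mul_atTop two_pos
  have hb : ∀ N, ‖∑ k ∈ Finset.range N, Real.sin ((2 * (k : ℝ) + 1) * x)‖
      ≤ 1 / |Real.sin x| := fun N => by
    simpa using abs_sum_sin_odd_shift_le hx 0 N
  have h := hanti.cauchySeq_series_mul_of_tendsto_zero_of_bounded hlim hb
  exact cauchySeq_tendsto_of_complete h

theorem exists_tendsto_integral_mul_squareWaveSum {K φ : ℝ → ℝ} {a b : ℝ}
    (hK : IntervalIntegrable K volume a b) (hφ : Continuous φ) :
    ∃ S, Tendsto (fun N => ∫ t in a..b, K t * squareWaveSum N (φ t)) atTop (nhds S) := by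
  choose F hF using exists_tendsto_squareWaveSum
  refine ⟨∫ t in a..b, K t * F (φ t),
    intervalIntegral.tendsto_integral_filter_of_dominated_convergence (fun t => |K t| * 3)
      (.of_forall fun N => ?_) (.of_forall fun N => .of_forall fun t _ => ?_)
      (hK.abs.mul_const 3) (.of_forall fun t _ => (hF (φ t)).const_mul _)⟩
  · exact hK.def'.aestronglyMeasurable.mul
      ((continuous_squareWaveSum N).comp hφ).aestronglyMeasurable
  · rw [Real.norm_eq_abs, abs_mul]
    exact mul_le_mul_of_nonneg_left (abs_squareWaveSum_le N _) (abs_nonneg _)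

theorem integral_mul_squareWaveSum {K φ : ℝ → ℝ} {a b : ℝ}
    (hK : IntervalIntegrable K volume a b) (hφ : Continuous φ) (N : ℕ) :
    ∫ t in a..b, K t * squareWaveSum N (φ t) = ∑ k ∈ Finset.range N,
      (2 * (k : ℝ) + 1)⁻¹ * ∫ t in a..b, K t * Real.sin ((2 * (k : ℝ) + 1) * φ t) := by
  simp_rw [squareWaveSum, Finset.mul_sum, mul_left_comm (K _)]
  rw [intervalIntegral.integral_finsetSum]
  · simp_rw [intervalIntegral.integral_const_mul]
  · exact fun k _ => (hK.mul_continuousOn (by fun_prop)).const_mul _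

theorem sin_odd_mul_add_pi_div_two (k : ℕ) (x : ℝ) :
    Real.sin ((2 * (k : ℝ) + 1) * (x + π / 2)) = (-1) ^ k * Real.cos ((2 * (k : ℝ) + 1) * x) := by
  have h : (2 * (k : ℝ) + 1) * (x + π / 2) = (2 * (k : ℝ) + 1) * x + k * π + π / 2 := by ring
  rw [h, Real.sin_add_pi_div_two, Real.cos_add_nat_mul_pi]

/-- For any `K ∈ L₁` the two series `Σ λ_{(2k+1)n}/(2k+1)` and
`Σ (-1)^k μ_{(2k+1)n}/(2k+1)` converge. -/
theorem fourier_series_converge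
    (K : ℝ → ℝ) (hK : MemL1 K) (n : ℕ) (hn : 0 < n) :
    (∃ S : ℝ, SeriesSum (fun k => sinCoeff K ((2 * k + 1) * n) / (2 * (k : ℝ) + 1)) S) ∧
    (∃ S : ℝ, SeriesSum
      (fun k => (-1 : ℝ) ^ k * cosCoeff K ((2 * k + 1) * n) / (2 * (k : ℝ) + 1)) S) := by
  have hK' := hK.2
  constructor
  · have hφ : Continuous fun t : ℝ => (n : ℝ) * t := by fun_prop
    obtain ⟨S, hS⟩ := exists_tendsto_integral_mul_squareWaveSum hK' hφ
    refine ⟨1 / π * S, (hS.const_mul (1 / π)).congr fun N => ?_⟩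
    rw [integral_mul_squareWaveSum hK' hφ, Finset.mul_sum]
    refine Finset.sum_congr rfl fun k _ => ?_
    simp only [sinCoeff, Nat.cast_mul, Nat.cast_add, Nat.cast_ofNat, Nat.cast_one, mul_assoc]
    ring
  · have hφ : Continuous fun t : ℝ => (n : ℝ) * t + π / 2 := by fun_prop
    obtain ⟨S, hS⟩ := exists_tendsto_integral_mul_squareWaveSum hK' hφ
    refine ⟨1 / π * S, (hS.const_mul (1 / π)).congr fun N => ?_⟩
    rw [integral_mul_squareWaveSum hK' hφ, Finset.mul_sum]
    refine Finset.sum_congr rfl fun k _ => ?_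
    simp only [sin_odd_mul_add_pi_div_two, mul_left_comm (K _),
      intervalIntegral.integral_const_mul, cosCoeff, Nat.cast_mul, Nat.cast_add,
      Nat.cast_ofNat, Nat.cast_one, mul_assoc]
    ring
end

section
/- Let f, φ ∈ L₁ be 2π-periodic, let f be odd with f(t) ≥ 0 for almost all t ∈ (0,π), and let φ be even and decreasing on (0,π). Then the convolution F = f*φ, F(x) = (1/2π)∫_{−π}^{π} f(t)φ(x−t)dt, is odd and F(t) ≥ 0 for almost all t ∈ (0,π). -/
open MeasureTheory Real Set Filter
open scoped ENNReal

/-- The convolution of an even function with an odd function is odd. -/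
theorem conv_neg_of_even_of_odd {f φ : ℝ → ℝ} (hodd : ∀ t, f (-t) = -f t)
    (heven : ∀ t, φ (-t) = φ t) (x : ℝ) : conv φ f (-x) = -conv φ f x := by
  have h := intervalIntegral.integral_comp_neg (a := -π) (b := π) (fun t => φ (-x - t) * f t)
  rw [neg_neg] at h
  have h2 : ∀ t, φ (-x - -t) * f (-t) = -(φ (x - t) * f t) := fun t => by
    rw [hodd, show -x - -t = -(x - t) by ring, heven, mul_neg]
  simp only [h2, intervalIntegral.integral_neg] at h
  rw [conv, conv, ← h, mul_neg]

/-- An even `2π`-periodic function that decreases on `(0, π)` takes at `x + t` a value at most the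
one at `x - t`, because `x + t` is farther from `2πℤ`. -/
theorem apply_add_le_apply_sub {φ : ℝ → ℝ} (hper : Function.Periodic φ (2 * π))
    (heven : ∀ t, φ (-t) = φ t)
    (hdec : ∀ x y : ℝ, 0 < x → x ≤ y → y < π → φ y ≤ φ x)
    {x t : ℝ} (hx : x ∈ Ioo 0 π) (ht : t ∈ Ioo 0 π) (hne : t ≠ x) (hne_pi : t ≠ π - x) :
    φ (x + t) ≤ φ (x - t) := by
  obtain ⟨hx0, hxπ⟩ := hx
  obtain ⟨ht0, htπ⟩ := ht
  have habs : φ (x - t) = φ |x - t| := by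
    rcases abs_choice (x - t) with h | h <;> rw [h]
    exact (heven _).symm
  have hpos : 0 < |x - t| := abs_pos.2 (sub_ne_zero.2 hne.symm)
  rw [habs]
  rcases lt_or_gt_of_ne hne_pi with h | h
  · exact hdec _ _ hpos (abs_le.2 ⟨by linarith, by linarith⟩) (by linarith)
  · have hrefl : φ (x + t) = φ (2 * π - (x + t)) := by
      rw [hper.sub_eq', heven]
    rw [hrefl]
    exact hdec _ _ hpos (abs_le.2 ⟨by linarith, by linarith⟩) (by linarith)

/-- The convolution of an a.e. nonnegative (on `(0,π)`) odd function with an even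
function decreasing on `(0,π)` is odd and a.e. nonnegative on `(0,π)`. -/
theorem conv_odd_nonneg
    (f φ : ℝ → ℝ) (hf : MemL1 f) (hφ : MemL1 φ)
    (hodd : ∀ t, f (-t) = -f t)
    (hfpos : ∀ᵐ t ∂(volume.restrict (Ioo 0 π)), 0 ≤ f t)
    (heven : ∀ t, φ (-t) = φ t)
    (hdec : ∀ x y : ℝ, 0 < x → x ≤ y → y < π → φ y ≤ φ x) :
    (∀ x : ℝ, conv φ f (-x) = -conv φ f x) ∧
    (∀ᵐ t ∂(volume.restrict (Ioo 0 π)), 0 ≤ conv φ f t) := by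
  refine ⟨conv_neg_of_even_of_odd hodd heven, ?_⟩
  filter_upwards [ae_restrict_mem measurableSet_Ioo] with x hx
  refine mul_nonneg (by positivity) ?_
  by_cases hint : IntervalIntegrable (fun t => φ (x - t) * f t) volume (-π) π
  swap
  · rw [intervalIntegral.integral_undef hint]
  have hneg : IntervalIntegrable (fun t => φ (x - t) * f t) volume (-π) 0 :=
    hint.mono_set (uIcc_subset_uIcc_left (by simp [pi_nonneg]))
  have hpos : IntervalIntegrable (fun t => φ (x - t) * f t) volume 0 π :=
    hint.mono_set (uIcc_subset_uIcc_right (by simp [pi_nonneg]))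
  have hneg' : IntervalIntegrable (fun t => φ (x - -t) * f (-t)) volume 0 π := by
    simpa using ((IntervalIntegrable.iff_comp_neg enorm_ne_top).1 hneg).symm
  have hfold : ∫ t in (-π)..0, φ (x - t) * f t = ∫ t in 0..π, φ (x - -t) * f (-t) := by
    simpa using (intervalIntegral.integral_comp_neg (a := 0) (b := π)
      (fun t => φ (x - t) * f t)).symm
  rw [← intervalIntegral.integral_add_adjacent_intervals hneg hpos, hfold,
    ← intervalIntegral.integral_add hneg' hpos, intervalIntegral.integral_of_le pi_nonneg,
    integral_Ioc_eq_integral_Ioo]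
  refine integral_nonneg_of_ae ?_
  filter_upwards [ae_restrict_mem measurableSet_Ioo, hfpos,
    ae_restrict_of_ae (volume.ae_ne x), ae_restrict_of_ae (volume.ae_ne (π - x))]
    with t ht hft hne hne_pi
  have hle := apply_add_le_apply_sub hφ.1 heven hdec hx ht hne hne_pi
  rw [hodd, sub_neg_eq_add, Pi.zero_apply]
  linarith [mul_nonneg (sub_nonneg.2 hle) hft]
end

section
/- Let f be a positive definite continuous function on ℝ. If the series Σ_{k∈ℤ} f(k)e^{ikt} is the Fourier series of a function S ∈ L₁, then S(t) ≥ 0 for almost all t ∈ ℝ. -/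
open MeasureTheory Real Set Filter
open scoped ENNReal

/-- A positive definite function on `ℝ`: all quadratic forms are real and nonnegative. -/
def IsPosDefFn (f : ℝ → ℂ) : Prop :=
  ∀ (n : ℕ) (x : Fin n → ℝ) (c : Fin n → ℂ),
    0 ≤ (∑ k, ∑ j, c k * (starRingEnd ℂ) (c j) * f (x k - x j)).re ∧
    (∑ k, ∑ j, c k * (starRingEnd ℂ) (c j) * f (x k - x j)).im = 0

/-- The fact that the period `2π` is positive. -/
theorem fact_two_pi_pos : Fact (0 < 2 * π) := ⟨Real.two_pi_pos⟩

attribute [local instance] fact_two_pi_pos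

/-- The integral of `S * ‖P‖ ^ 2` over a period, for a trigonometric polynomial `P`, is a quadratic
form in the Fourier coefficients of `S`. -/
theorem integral_mul_norm_sq_trigPoly (S : ℝ → ℝ) (hS : IntegrableOn S (Ioc (-π) π)) {n : ℕ}
    (m : Fin n → ℤ) (c : Fin n → ℂ) :
    ((∫ t in Ioc (-π) π, S t * ‖∑ k, c k * fourier (m k) (t : AddCircle (2 * π))‖ ^ 2 : ℝ) : ℂ) =
      ∑ k, ∑ j, c k * (starRingEnd ℂ) (c j) *
        ∫ t in Ioc (-π) π, (S t : ℂ) * Complex.exp (-Complex.I * (m j - m k : ℤ) * t) := by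
  have hint : ∀ k j : Fin n, IntegrableOn (fun t : ℝ => c k * (starRingEnd ℂ) (c j) *
      ((S t : ℂ) * Complex.exp (-Complex.I * (m j - m k : ℤ) * t))) (Ioc (-π) π) := by
    intro k j
    refine Integrable.const_mul ?_ _
    refine Integrable.mul_bdd (c := 1) hS.ofReal ?_ ?_
    · exact Continuous.aestronglyMeasurable (by fun_prop)
    · refine Eventually.of_forall fun t => ?_
      have : -Complex.I * (m j - m k : ℤ) * t = ((-(m j - m k : ℤ) * t : ℝ) : ℂ) * Complex.I := by
        push_cast; ring
      rw [this, Complex.norm_exp_ofReal_mul_I]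
  simp_rw [← integral_const_mul]
  rw [← integral_complex_ofReal]
  have hsum : ∀ k : Fin n, ∑ j, ∫ t in Ioc (-π) π, c k * (starRingEnd ℂ) (c j) *
      ((S t : ℂ) * Complex.exp (-Complex.I * (m j - m k : ℤ) * t)) =
      ∫ t in Ioc (-π) π, ∑ j, c k * (starRingEnd ℂ) (c j) *
      ((S t : ℂ) * Complex.exp (-Complex.I * (m j - m k : ℤ) * t)) := fun k =>
    (integral_finsetSum _ fun j _ => hint k j).symm
  simp_rw [hsum]
  rw [← integral_finsetSum _ fun k _ => integrable_finsetSum _ fun j _ => hint k j]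
  congr 1
  ext t
  push_cast
  rw [← Complex.mul_conj', map_sum, Finset.sum_mul_sum, Finset.mul_sum]
  refine Finset.sum_congr rfl fun k _ => ?_
  rw [Finset.mul_sum]
  refine Finset.sum_congr rfl fun j _ => ?_
  have hexp : Complex.exp (-Complex.I * ((m j : ℂ) - m k) * t) =
      fourier (m k) (t : AddCircle (2 * π)) *
        (starRingEnd ℂ) (fourier (m j) (t : AddCircle (2 * π))) := by
    rw [← fourier_neg, ← fourier_add, fourier_coe_apply]
    congr 1
    have : (π : ℂ) ≠ 0 := by exact_mod_cast Real.pi_ne_zero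
    push_cast
    field_simp
    ring
  rw [hexp, map_mul]
  ring

/-- If `S * ‖P‖ ^ 2` has nonnegative integral for all trigonometric polynomials `P`, then the same
holds for all continuous functions on the circle. -/
theorem integral_mul_norm_sq_nonneg_of_trigPoly (S : ℝ → ℝ) (hS : IntegrableOn S (Ioc (-π) π))
    (h : ∀ (n : ℕ) (m : Fin n → ℤ) (c : Fin n → ℂ),
      0 ≤ ∫ t in Ioc (-π) π, S t * ‖∑ k, c k * fourier (m k) (t : AddCircle (2 * π))‖ ^ 2)
    (g : C(AddCircle (2 * π), ℂ)) :
    0 ≤ ∫ t in Ioc (-π) π, S t * ‖g (t : AddCircle (2 * π))‖ ^ 2 := by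
  have hg : g ∈ closure
      (Submodule.span ℂ (Set.range (fourier (T := 2 * π))) : Set C(AddCircle (2 * π), ℂ)) := by
    rw [← Submodule.topologicalClosure_coe, span_fourier_closure_eq_top]
    trivial
  obtain ⟨P, hP, hlim⟩ := mem_closure_iff_seq_limit.1 hg
  obtain ⟨C, hC⟩ := hlim.norm.bddAbove_range
  have hPC : ∀ n (x : AddCircle (2 * π)), ‖P n x‖ ≤ C := fun n x =>
    ((P n).norm_coe_le_norm x).trans (hC ⟨n, rfl⟩)
  have hcoe : Continuous fun t : ℝ => (t : AddCircle (2 * π)) := AddCircle.continuous_mk' _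
  refine ge_of_tendsto' (f := fun n => ∫ t in Ioc (-π) π, S t * ‖P n (t : AddCircle (2 * π))‖ ^ 2)
    (x := atTop) ?_ fun n => ?_
  · refine tendsto_integral_of_dominated_convergence (fun t => ‖S t‖ * C ^ 2) ?_ ?_ ?_ ?_
    · intro n
      refine hS.aestronglyMeasurable.mul (Continuous.aestronglyMeasurable ?_)
      exact (((P n).continuous.comp hcoe).norm).pow 2
    · exact hS.norm.mul_const _
    · refine fun n => Eventually.of_forall fun t => ?_
      rw [norm_mul, norm_pow, norm_norm]
      gcongr
      exact hPC n t
    · refine Eventually.of_forall fun t => ?_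
      exact (((((continuous_eval_const (F := C(AddCircle (2 * π), ℂ)) (t : AddCircle (2 * π))).tendsto g).comp
        hlim).norm).pow 2).const_mul (S t)
  · obtain ⟨c, hc⟩ := Finsupp.mem_span_range_iff_exists_finsupp.1 (hP n)
    let e := c.support.equivFin.symm
    have hsum : ∀ x : AddCircle (2 * π),
        P n x = ∑ k, c (e k) * fourier (e k : ℤ) x := by
      intro x
      rw [e.sum_comp (fun i : c.support => c i * fourier (i : ℤ) x), ← hc,
        Finset.sum_coe_sort c.support (fun i => c i * fourier i x)]
      simp [Finsupp.sum, ContinuousMap.sum_apply]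
    simp_rw [hsum]
    exact h _ _ _

/-- If `S * ‖g‖ ^ 2` has nonnegative integral for all continuous functions `g` on the circle, then
so does `S` on every compact subset of the open period interval. -/
theorem setIntegral_nonneg_of_isCompact (S : ℝ → ℝ) (hS : IntegrableOn S (Ioc (-π) π))
    (h : ∀ g : C(AddCircle (2 * π), ℂ),
      0 ≤ ∫ t in Ioc (-π) π, S t * ‖g (t : AddCircle (2 * π))‖ ^ 2)
    {K : Set ℝ} (hK : IsCompact K) (hKI : K ⊆ Ioo (-π) π) :
    0 ≤ ∫ t in K, S t := by
  have hcoe : Continuous fun t : ℝ => (t : AddCircle (2 * π)) := AddCircle.continuous_mk' _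
  set F : Set (AddCircle (2 * π)) := (fun t : ℝ => (t : AddCircle (2 * π))) '' K
  have hFc : closure F = F := (hK.image hcoe).isClosed.closure_eq
  have hmem : ∀ t ∈ Ioo (-π) π, (t : AddCircle (2 * π)) ∈ F ↔ t ∈ K := by
    intro t ht
    refine ⟨?_, fun hk => ⟨t, hk, rfl⟩⟩
    rintro ⟨s, hs, hst⟩
    have hI : ∀ r ∈ Ioo (-π) π, r ∈ Ico (-π) (-π + 2 * π) := fun r hr =>
      ⟨hr.1.le, by linarith [hr.2]⟩
    have := (AddCircle.coe_eq_coe_iff_of_mem_Ico (hI s (hKI hs)) (hI t ht)).1 hst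
    exact this ▸ hs
  have hδ : ∀ n : ℕ, (0 : ℝ) < 1 / (n + 1) := fun n => Nat.one_div_pos_of_nat
  have hlim := tendsto_pi_nhds.1
    (thickenedIndicator_tendsto_indicator_closure hδ tendsto_one_div_add_atTop_nhds_zero_nat F)
  rw [hFc] at hlim
  let g : ℕ → C(AddCircle (2 * π), ℂ) := fun n =>
    ⟨fun x => ((thickenedIndicator (hδ n) F x : ℝ) : ℂ),
      Complex.continuous_ofReal.comp
        (NNReal.continuous_coe.comp (thickenedIndicator (hδ n) F).continuous)⟩
  have hgn : ∀ n x, ‖g n x‖ = (thickenedIndicator (hδ n) F x : ℝ) := fun n x => by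
    simp [g]
  have hset : ∫ t in K, S t = ∫ t in Ioo (-π) π, K.indicator S t := by
    rw [setIntegral_indicator hK.measurableSet, inter_eq_self_of_subset_right hKI]
  have hS' : IntegrableOn S (Ioo (-π) π) := hS.mono_set Ioo_subset_Ioc_self
  rw [hset]
  refine ge_of_tendsto'
    (f := fun n => ∫ t in Ioo (-π) π, S t * ‖g n (t : AddCircle (2 * π))‖ ^ 2)
    (x := atTop) ?_ fun n => ?_
  · refine tendsto_integral_of_dominated_convergence (fun t => ‖S t‖) ?_ ?_ ?_ ?_
    · intro n
      refine hS'.aestronglyMeasurable.mul (Continuous.aestronglyMeasurable ?_)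
      exact (((g n).continuous.comp hcoe).norm).pow 2
    · exact hS'.norm
    · refine fun n => Eventually.of_forall fun t => ?_
      rw [norm_mul, norm_pow, norm_norm, hgn]
      refine mul_le_of_le_one_right (norm_nonneg _) (pow_le_one₀ NNReal.zero_le_coe ?_)
      exact_mod_cast thickenedIndicator_le_one (hδ n) F t
    · refine (ae_restrict_mem measurableSet_Ioo).mono fun t ht => ?_
      simp_rw [hgn]
      have ht' := (((NNReal.continuous_coe.tendsto _).comp
        (hlim (t : AddCircle (2 * π)))).pow 2).const_mul (S t)
      have hval : S t * ((F.indicator (fun _ => 1) (t : AddCircle (2 * π)) : NNReal) : ℝ) ^ 2 =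
          K.indicator S t := by
        by_cases htK : t ∈ K
        · simp [htK, (hmem t ht).2 htK]
        · simp [htK, mt (hmem t ht).1 htK]
      rw [← hval]
      exact ht'
  · rw [← integral_Ioc_eq_integral_Ioo]
    exact h (g n)

/-- An integrable function on an open interval whose integrals over compact subsets are nonnegative
is nonnegative almost everywhere. -/
theorem ae_nonneg_of_forall_isCompact_setIntegral_nonneg {S : ℝ → ℝ} {a b : ℝ}
    (hS : IntegrableOn S (Ioo a b))
    (h : ∀ K : Set ℝ, IsCompact K → K ⊆ Ioo a b → 0 ≤ ∫ t in K, S t) :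
    ∀ᵐ t ∂volume.restrict (Ioo a b), 0 ≤ S t := by
  have hm := hS.aestronglyMeasurable
  set g := hm.mk S
  have hSg : S =ᵐ[volume.restrict (Ioo a b)] g := hm.ae_eq_mk
  have hA : MeasurableSet ({t | g t < 0} ∩ Ioo a b) :=
    (measurableSet_lt hm.stronglyMeasurable_mk.measurable measurable_const).inter measurableSet_Ioo
  suffices h0 : volume ({t | g t < 0} ∩ Ioo a b) = 0 by
    have hg : ∀ᵐ t ∂volume.restrict (Ioo a b), 0 ≤ g t := by
      rw [ae_iff, Measure.restrict_apply' measurableSet_Ioo]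
      simpa only [not_le] using h0
    filter_upwards [hSg, hg] with t h1 h2
    rwa [h1]
  by_contra h0
  obtain ⟨K, hKA, hK, hKpos⟩ := hA.exists_lt_isCompact (pos_iff_ne_zero.2 h0)
  have hKI : K ⊆ Ioo a b := hKA.trans inter_subset_right
  have hSgK : S =ᵐ[volume.restrict K] g := ae_restrict_of_ae_restrict_of_subset hKI hSg
  have hgK : IntegrableOn g K := (hS.mono_set hKI).congr hSgK
  have hpos : 0 < ∫ t in K, -g t := by
    rw [setIntegral_pos_iff_support_of_nonneg_ae (f := fun t => -g t) ?_ hgK.neg]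
    · refine hKpos.trans_le (measure_mono fun t ht => ⟨?_, ht⟩)
      exact neg_ne_zero.2 (hKA ht).1.ne
    · exact (ae_restrict_mem hK.measurableSet).mono fun t ht => neg_nonneg.2 (hKA ht).1.le
  have := h K hK hKI
  rw [integral_congr_ae hSgK] at this
  rw [integral_neg] at hpos
  linarith

/-- A property of the values of a periodic function that holds almost everywhere on a period holds
almost everywhere. -/
theorem ae_of_ae_restrict_Ioc_of_periodic {S : ℝ → ℝ} {T a : ℝ} (hT : 0 < T)
    (hS : Function.Periodic S T) {p : ℝ → Prop}
    (h : ∀ᵐ t ∂volume.restrict (Ioc a (a + T)), p (S t)) : ∀ᵐ t, p (S t) := by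
  rw [ae_restrict_iff' measurableSet_Ioc] at h
  have hall : ∀ᵐ t : ℝ, ∀ n : ℤ, t + n • T ∈ Ioc a (a + T) → p (S (t + n • T)) :=
    ae_all_iff.2 fun n =>
      (measurePreserving_add_right volume (n • T)).quasiMeasurePreserving.ae h
  filter_upwards [hall] with t ht
  obtain ⟨n, hn, -⟩ := existsUnique_add_zsmul_mem_Ioc hT t a
  have := ht n hn
  rwa [hS.zsmul n t] at this

/-- If `f` is positive definite and continuous on `ℝ` and `Σ f(k) e^{ikt}` is the
Fourier series of `S ∈ L₁`, then `S ≥ 0` a.e. -/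
theorem nonneg_of_posdef_coeffs
    (f : ℝ → ℂ) (hfc : Continuous f) (hpd : IsPosDefFn f)
    (S : ℝ → ℝ) (hS : MemL1 S)
    (hFour : ∀ k : ℤ, (1 / (2 * (π : ℂ))) *
      ∫ t in (-π)..π, (S t : ℂ) * Complex.exp (-Complex.I * k * t) = f k) :
    ∀ᵐ t : ℝ ∂volume, 0 ≤ S t := by
  have hI : IntegrableOn S (Ioc (-π) π) :=
    (intervalIntegrable_iff_integrableOn_Ioc_of_le (by linarith [Real.pi_pos])).1 hS.2
  have hcoef : ∀ k : ℤ, ∫ t in Ioc (-π) π, (S t : ℂ) * Complex.exp (-Complex.I * k * t) =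
      2 * π * f k := by
    intro k
    have hπ : (π : ℂ) ≠ 0 := by exact_mod_cast Real.pi_ne_zero
    rw [← hFour k, intervalIntegral.integral_of_le (by linarith [Real.pi_pos])]
    field_simp
  have htrig : ∀ (n : ℕ) (m : Fin n → ℤ) (c : Fin n → ℂ), 0 ≤ ∫ t in Ioc (-π) π,
      S t * ‖∑ k, c k * fourier (m k) (t : AddCircle (2 * π))‖ ^ 2 := by
    intro n m c
    have hquad := (hpd n (fun k => -(m k : ℝ)) c).1
    have key := integral_mul_norm_sq_trigPoly S hI m c
    simp_rw [hcoef] at key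
    have hfac : ∑ k, ∑ j, c k * (starRingEnd ℂ) (c j) * (2 * π * f (m j - m k : ℤ)) =
        ((2 * π : ℝ) : ℂ) *
          ∑ k, ∑ j, c k * (starRingEnd ℂ) (c j) * f (-(m k : ℝ) - -(m j : ℝ)) := by
      simp_rw [Finset.mul_sum]
      refine Finset.sum_congr rfl fun k _ => Finset.sum_congr rfl fun j _ => ?_
      have : ((m j - m k : ℤ) : ℝ) = -(m k : ℝ) - -(m j : ℝ) := by push_cast; ring
      rw [this]
      push_cast
      ring
    rw [hfac] at key
    have hre := congrArg Complex.re key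
    rw [Complex.ofReal_re, Complex.re_ofReal_mul] at hre
    rw [hre]
    exact mul_nonneg Real.two_pi_pos.le hquad
  have hcont := integral_mul_norm_sq_nonneg_of_trigPoly S hI htrig
  have hIoo := ae_nonneg_of_forall_isCompact_setIntegral_nonneg (hI.mono_set Ioo_subset_Ioc_self)
    fun K hK hKI => setIntegral_nonneg_of_isCompact S hI hcont hK hKI
  rw [restrict_Ioo_eq_restrict_Ioc] at hIoo
  refine ae_of_ae_restrict_Ioc_of_periodic (a := -π) Real.two_pi_pos hS.1 (p := fun y => 0 ≤ y) ?_
  rwa [show -π + 2 * π = π by ring]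
end

section
/- Let m ∈ ℕ and let h ∈ M_{m+1} be such that the finite limit h(+0) exists and h(+0) ≤ 1. Then the function λ(x) = (1−h(x))/x belongs to M_k for every k = 1,…,m. -/
open MeasureTheory Real Set Filter
open scoped ENNReal

/-- The class `M_m` of multiply monotone functions: `h ∈ C^{m-1}(0,∞)`,
`(-1)^{m-1} h^{(m-1)}` is nonnegative, decreasing and convex on `(0,∞)`,
and the finite limit `h(+∞) ≥ 0` exists. -/
def MemM (m : ℕ) (h : ℝ → ℝ) : Prop :=
  ContDiffOn ℝ (m - 1 : ℕ) h (Ioi 0) ∧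
  (∀ x ∈ Ioi (0 : ℝ), 0 ≤ (-1 : ℝ) ^ (m - 1) * iteratedDerivWithin (m - 1) h (Ioi 0) x) ∧
  AntitoneOn (fun x => (-1 : ℝ) ^ (m - 1) * iteratedDerivWithin (m - 1) h (Ioi 0) x) (Ioi 0) ∧
  ConvexOn ℝ (Ioi 0) (fun x => (-1 : ℝ) ^ (m - 1) * iteratedDerivWithin (m - 1) h (Ioi 0) x) ∧
  ∃ L : ℝ, 0 ≤ L ∧ Tendsto h atTop (nhds L)

/-- `γ_m(ρ, h)`: supremum of those `γ` for which `λ_{ρ,γ} ∈ M_m`. -/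
noncomputable def gammam (m : ℕ) (ρ : ℝ) (h : ℝ → ℝ) : ℝ :=
  sSup {γ : ℝ | MemM m (fun x => (1 - (1 + γ * x) * h x) / x ^ ρ)}

/-- `g` is nonnegative, decreasing and convex on `(0,∞)`. -/
structure NonnegAntitoneConvex (g : ℝ → ℝ) : Prop where
  nonneg : ∀ x ∈ Ioi (0 : ℝ), 0 ≤ g x
  antitone : AntitoneOn g (Ioi 0)
  convex : ConvexOn ℝ (Ioi 0) g

namespace NonnegAntitoneConvex

variable {f g : ℝ → ℝ}

theorem congr (hf : NonnegAntitoneConvex f) (hfg : EqOn f g (Ioi 0)) :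
    NonnegAntitoneConvex g where
  nonneg x hx := hfg hx ▸ hf.nonneg x hx
  antitone := hf.antitone.congr hfg
  convex := hf.convex.congr hfg

theorem continuousOn (hg : NonnegAntitoneConvex g) : ContinuousOn g (Ioi 0) :=
  hg.convex.continuousOn isOpen_Ioi

theorem add (hf : NonnegAntitoneConvex f) (hg : NonnegAntitoneConvex g) :
    NonnegAntitoneConvex (fun x => f x + g x) where
  nonneg x hx := add_nonneg (hf.nonneg x hx) (hg.nonneg x hx)
  antitone := hf.antitone.add hg.antitone
  convex := hf.convex.add hg.convex

theorem const_mul {c : ℝ} (hc : 0 ≤ c) (hg : NonnegAntitoneConvex g) :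
    NonnegAntitoneConvex (fun x => c * g x) where
  nonneg x hx := mul_nonneg hc (hg.nonneg x hx)
  antitone _ hx _ hy hxy := mul_le_mul_of_nonneg_left (hg.antitone hx hy hxy) hc
  convex := hg.convex.smul hc

theorem inv_pow (n : ℕ) : NonnegAntitoneConvex (fun x => (x ^ n)⁻¹) where
  nonneg x hx := by
    have : 0 < x := hx
    positivity
  antitone x hx y hy hxy := by
    have : 0 < x := hx
    simp only
    gcongr
  convex := by simpa using convexOn_zpow (𝕜 := ℝ) (-(n : ℤ))

theorem of_tendsto {ι : Type*} {l : Filter ι} [l.NeBot] {F : ι → ℝ → ℝ}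
    (hF : ∀ᶠ i in l, NonnegAntitoneConvex (F i))
    (hlim : ∀ x ∈ Ioi (0 : ℝ), Tendsto (fun i => F i x) l (nhds (g x))) :
    NonnegAntitoneConvex g where
  nonneg x hx := ge_of_tendsto (hlim x hx) (hF.mono fun _ hi => hi.nonneg x hx)
  antitone x hx y hy hxy :=
    le_of_tendsto_of_tendsto (hlim y hy) (hlim x hx) (hF.mono fun _ hi => hi.antitone hx hy hxy)
  convex := ⟨convex_Ioi 0, fun x hx y hy a b ha hb hab =>
    le_of_tendsto_of_tendsto (hlim _ (convex_Ioi 0 hx hy ha hb hab))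
      (((hlim x hx).const_smul a).add ((hlim y hy).const_smul b))
      (hF.mono fun _ hi => hi.convex.2 hx hy ha hb hab)⟩

theorem intervalIntegrable_dilation (hg : NonnegAntitoneConvex g) (n : ℕ) {a b x : ℝ}
    (ha : 0 < a) (hab : a ≤ b) (hx : 0 < x) :
    IntervalIntegrable (fun t => t ^ n * g (t * x)) volume a b := by
  apply ContinuousOn.intervalIntegrable
  rw [uIcc_of_le hab]
  refine (by fun_prop : ContinuousOn (fun t : ℝ => t ^ n) _).mul
    (hg.continuousOn.comp (by fun_prop) fun t ht => ?_)
  exact mul_pos (ha.trans_le ht.1) hx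

/-- Averages of dilations of `g` inherit nonnegativity, monotonicity and convexity. -/
theorem integral_dilation (hg : NonnegAntitoneConvex g) (n : ℕ) {a b : ℝ}
    (ha : 0 < a) (hab : a ≤ b) :
    NonnegAntitoneConvex (fun x => ∫ t in a..b, t ^ n * g (t * x)) where
  nonneg x hx := intervalIntegral.integral_nonneg hab fun t ht => by
    have ht0 : 0 < t := ha.trans_le ht.1
    exact mul_nonneg (by positivity) (hg.nonneg _ (mul_pos ht0 hx))
  antitone x hx y hy hxy := by
    refine intervalIntegral.integral_mono_on hab (hg.intervalIntegrable_dilation n ha hab hy)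
      (hg.intervalIntegrable_dilation n ha hab hx) fun t ht => ?_
    have ht0 : 0 < t := ha.trans_le ht.1
    exact mul_le_mul_of_nonneg_left
      (hg.antitone (mul_pos ht0 hx) (mul_pos ht0 hy) (by gcongr)) (by positivity)
  convex := by
    refine ⟨convex_Ioi 0, fun x hx y hy c d hc hd hcd => ?_⟩
    have hxi := hg.intervalIntegrable_dilation n ha hab hx
    have hyi := hg.intervalIntegrable_dilation n ha hab hy
    have hz := convex_Ioi (0 : ℝ) hx hy hc hd hcd
    simp only [smul_eq_mul] at hz ⊢
    rw [← intervalIntegral.integral_const_mul, ← intervalIntegral.integral_const_mul,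
      ← intervalIntegral.integral_add (hxi.const_mul c) (hyi.const_mul d)]
    refine intervalIntegral.integral_mono_on hab (hg.intervalIntegrable_dilation n ha hab hz)
      ((hxi.const_mul c).add (hyi.const_mul d)) fun t ht => ?_
    have ht0 : 0 < t := ha.trans_le ht.1
    have key := hg.convex.2 (mul_pos ht0 hx) (mul_pos ht0 hy) hc hd hcd
    simp only [smul_eq_mul] at key
    calc t ^ n * g (t * (c * x + d * y))
        = t ^ n * g (c * (t * x) + d * (t * y)) := by ring_nf
      _ ≤ t ^ n * (c * g (t * x) + d * g (t * y)) :=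
        mul_le_mul_of_nonneg_left key (by positivity)
      _ = c * (t ^ n * g (t * x)) + d * (t ^ n * g (t * y)) := by ring

theorem of_hasDerivAt {g' : ℝ → ℝ} (hg' : NonnegAntitoneConvex g')
    (hd : ∀ x ∈ Ioi (0 : ℝ), HasDerivAt g (-g' x) x) (h0 : ∀ x ∈ Ioi (0 : ℝ), 0 ≤ g x) :
    NonnegAntitoneConvex g where
  nonneg := h0
  antitone := antitoneOn_of_deriv_nonpos (convex_Ioi 0) (HasDerivAt.continuousOn hd)
    (fun x hx => (hd x (interior_subset hx)).differentiableAt.differentiableWithinAt)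
    fun x hx => by
      have hx := interior_subset hx
      rw [(hd x hx).deriv]
      exact neg_nonpos.2 (hg'.nonneg x hx)
  convex := by
    refine MonotoneOn.convexOn_of_deriv (convex_Ioi 0) (HasDerivAt.continuousOn hd)
      (fun x hx => (hd x (interior_subset hx)).differentiableAt.differentiableWithinAt) ?_
    intro x hx y hy hxy
    have hx := interior_subset hx
    have hy := interior_subset hy
    rw [(hd x hx).deriv, (hd y hy).deriv]
    exact neg_le_neg (hg'.antitone hx hy hxy)

end NonnegAntitoneConvex

theorem tendsto_atBot_of_hasDerivAt_le {f f' : ℝ → ℝ} {c : ℝ} (hc : 0 < c)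
    (hd : ∀ x ∈ Ioi (0 : ℝ), HasDerivAt f (f' x) x) (hf' : ∀ᶠ x in atTop, f' x ≤ -c) :
    Tendsto f atTop atBot := by
  obtain ⟨a, ha⟩ := eventually_atTop.1 (hf'.and (eventually_gt_atTop 0))
  have hpos : ∀ x ∈ Ici a, x ∈ Ioi (0 : ℝ) := fun x hx => (ha x hx).2
  have hle : ∀ x ∈ Ici a, f x ≤ f a + -c * (x - a) := fun x hx => by
    have := (convex_Ici a).image_sub_le_mul_sub_of_deriv_le
      (HasDerivAt.continuousOn fun y hy => hd y (hpos y hy))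
      (fun y hy => (hd y (hpos y (interior_subset hy))).differentiableAt.differentiableWithinAt)
      (C := -c) (fun y hy => by
        rw [(hd y (hpos y (interior_subset hy))).deriv]
        exact (ha y (interior_subset hy)).1) a self_mem_Ici x hx hx
    linarith
  refine tendsto_atBot_mono' atTop ((eventually_ge_atTop a).mono hle) ?_
  exact tendsto_atBot_add_const_left _ _
    ((tendsto_atTop_add_const_right atTop (-a) tendsto_id).const_mul_atTop_of_neg (by linarith))

theorem tendsto_atBot_of_iterated_hasDerivAt_le {n : ℕ} {f : ℕ → ℝ → ℝ} {c : ℝ} (hc : 0 < c)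
    (hd : ∀ j ≤ n, ∀ x ∈ Ioi (0 : ℝ), HasDerivAt (f j) (f (j + 1) x) x)
    (hf : ∀ᶠ x in atTop, f (n + 1) x ≤ -c) : Tendsto (f 0) atTop atBot := by
  induction n generalizing f c with
  | zero => exact tendsto_atBot_of_hasDerivAt_le hc (hd 0 le_rfl) hf
  | succ n ih =>
    have h1 : Tendsto (f 1) atTop atBot :=
      ih (f := fun j => f (j + 1)) hc (fun j hj => hd (j + 1) (by omega)) hf
    exact tendsto_atBot_of_hasDerivAt_le one_pos (hd 0 (by omega)) (h1.eventually_le_atBot (-1))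

/-- A sequence `g 0, …, g m` of functions with `g (j + 1) = -(g j)'` on `(0,∞)`, that is,
`g j = (-1) ^ j * (g 0)^(j)`. -/
def AltDerivChain (m : ℕ) (g : ℕ → ℝ → ℝ) : Prop :=
  ∀ j < m, ∀ x ∈ Ioi (0 : ℝ), HasDerivAt (g j) (-g (j + 1) x) x

theorem altDerivChain_iteratedDerivWithin {m : ℕ} {h : ℝ → ℝ} (hh : ContDiffOn ℝ m h (Ioi 0)) :
    AltDerivChain m (fun j x => (-1 : ℝ) ^ j * iteratedDerivWithin j h (Ioi 0) x) := by
  intro j hj x hx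
  have hdiff := hh.differentiableOn_iteratedDerivWithin (m := j) (by exact_mod_cast hj)
    (uniqueDiffOn_Ioi 0) x hx
  have hd := (hdiff.hasDerivWithinAt.hasDerivAt (Ioi_mem_nhds hx)).const_mul ((-1 : ℝ) ^ j)
  rw [← iteratedDerivWithin_succ] at hd
  exact hd.congr_deriv (by ring)

namespace AltDerivChain

variable {m n : ℕ} {g : ℕ → ℝ → ℝ}

theorem nonneg_of_antitoneOn (hg : AltDerivChain m g) {j : ℕ} (hj : j ≤ m)
    (hanti : AntitoneOn (g j) (Ioi 0)) {L : ℝ} (hL : 0 ≤ L) (hlim : Tendsto (g 0) atTop (nhds L)) :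
    ∀ x ∈ Ioi (0 : ℝ), 0 ≤ g j x := by
  intro x hx
  by_contra! hneg
  have hev : ∀ᶠ y in atTop, g j y ≤ -(-g j x) := by
    filter_upwards [eventually_ge_atTop x] with y hy
    rw [neg_neg]
    exact hanti hx (lt_of_lt_of_le hx hy) hy
  cases j with
  | zero =>
    have := le_of_tendsto hlim hev
    linarith
  | succ n =>
    have hd : ∀ i ≤ n, ∀ y ∈ Ioi (0 : ℝ), HasDerivAt (fun y => (-1 : ℝ) ^ (n + 1 + i) * g i y)
        ((-1 : ℝ) ^ (n + 1 + (i + 1)) * g (i + 1) y) y := fun i hi y hy => by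
      exact ((hg i (by omega) y hy).const_mul ((-1 : ℝ) ^ (n + 1 + i))).congr_deriv (by ring)
    have hbot := tendsto_atBot_of_iterated_hasDerivAt_le
      (f := fun i y => (-1 : ℝ) ^ (n + 1 + i) * g i y) (neg_pos.2 hneg) hd
      (by simpa [← two_mul] using hev)
    exact not_tendsto_nhds_of_tendsto_atBot hbot _ (hlim.const_mul _)

theorem nonnegAntitoneConvex (hg : AltDerivChain m g) (hm : NonnegAntitoneConvex (g m))
    {L : ℝ} (hL : 0 ≤ L) (hlim : Tendsto (g 0) atTop (nhds L)) {j : ℕ} (hj : j ≤ m) :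
    NonnegAntitoneConvex (g j) := by
  induction hj using Nat.decreasingInduction with
  | self => exact hm
  | of_succ j hj ih =>
    have hanti : AntitoneOn (g j) (Ioi 0) :=
      antitoneOn_of_deriv_nonpos (convex_Ioi 0) (HasDerivAt.continuousOn (hg j hj))
        (fun x hx => (hg j hj x (interior_subset hx)).differentiableAt.differentiableWithinAt)
        fun x hx => by
          have hx := interior_subset hx
          rw [(hg j hj x hx).deriv]
          exact neg_nonpos.2 (ih.nonneg x hx)
    exact ih.of_hasDerivAt (hg j hj) (hg.nonneg_of_antitoneOn hj.le hanti hL hlim)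

theorem half_mul_le_sub (hg : AltDerivChain m g) (hn : n < m)
    (hanti : AntitoneOn (g (n + 1)) (Ioi 0)) {x : ℝ} (hx : 0 < x) :
    x / 2 * g (n + 1) x ≤ g n (x / 2) - g n x := by
  have hpos : ∀ y ∈ Icc (x / 2) x, y ∈ Ioi (0 : ℝ) := fun y hy => lt_of_lt_of_le (half_pos hx) hy.1
  have := (convex_Icc (x / 2) x).image_sub_le_mul_sub_of_deriv_le
    (HasDerivAt.continuousOn fun y hy => hg n hn y (hpos y hy))
    (fun y hy => (hg n hn y (hpos y (interior_subset hy))).differentiableAt.differentiableWithinAt)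
    (C := -g (n + 1) x) (fun y hy => by
      have hy := interior_subset hy
      rw [(hg n hn y (hpos y hy)).deriv]
      exact neg_le_neg (hanti (hpos y hy) hx hy.2))
    (x / 2) ⟨le_rfl, by linarith⟩ x ⟨by linarith, le_rfl⟩ (by linarith)
  linarith

theorem tendsto_pow_mul_zero (hg : AltDerivChain m g)
    (hc : ∀ j ≤ m, NonnegAntitoneConvex (g j)) {L : ℝ}
    (h0 : Tendsto (g 0) (nhdsWithin 0 (Ioi 0)) (nhds L)) (hn : n < m) :
    Tendsto (fun x => x ^ (n + 1) * g (n + 1) x) (nhdsWithin 0 (Ioi 0)) (nhds 0) := by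
  have hhalf : Tendsto (fun x : ℝ => x / 2) (nhdsWithin 0 (Ioi 0)) (nhdsWithin 0 (Ioi 0)) := by
    refine tendsto_nhdsWithin_iff.2 ⟨?_, ?_⟩
    · have : Tendsto (fun x : ℝ => x / 2) (nhds 0) (nhds (0 / 2)) :=
        (continuous_id.div_const 2).tendsto 0
      exact (by simpa using this : Tendsto (fun x : ℝ => x / 2) (nhds 0) (nhds 0)).mono_left
        nhdsWithin_le_nhds
    · filter_upwards [self_mem_nhdsWithin] with x hx using half_pos (mem_Ioi.1 hx)
  have hnonneg : ∀ᶠ x in nhdsWithin (0 : ℝ) (Ioi 0), 0 ≤ x ^ (n + 1) * g (n + 1) x := by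
    filter_upwards [self_mem_nhdsWithin] with x hx
    have hx0 : 0 < x := hx
    exact mul_nonneg (by positivity) ((hc (n + 1) hn).nonneg x hx)
  induction n with
  | zero =>
    have hlim := ((h0.comp hhalf).sub h0).const_mul 2
    rw [sub_self, mul_zero] at hlim
    refine tendsto_of_tendsto_of_tendsto_of_le_of_le' tendsto_const_nhds hlim hnonneg ?_
    filter_upwards [self_mem_nhdsWithin] with x hx
    have := hg.half_mul_le_sub hn (hc 1 hn).antitone hx
    simp only [zero_add, pow_one, Function.comp_apply] at this ⊢
    linarith
  | succ n ih =>
    have hprev := ih (by omega) <| by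
      filter_upwards [self_mem_nhdsWithin] with x hx
      have hx0 : 0 < x := hx
      exact mul_nonneg (by positivity) ((hc (n + 1) (by omega)).nonneg x hx)
    have hlim := (hprev.comp hhalf).const_mul (2 ^ (n + 2))
    rw [mul_zero] at hlim
    refine tendsto_of_tendsto_of_tendsto_of_le_of_le' tendsto_const_nhds hlim hnonneg ?_
    filter_upwards [self_mem_nhdsWithin] with x hx
    have hx0 : 0 < x := hx
    have hle := hg.half_mul_le_sub hn (hc (n + 2) hn).antitone hx
    have hnn := (hc (n + 1) (by omega)).nonneg x hx
    calc x ^ (n + 1 + 1) * g (n + 1 + 1) x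
        = 2 * x ^ (n + 1) * (x / 2 * g (n + 1 + 1) x) := by ring
      _ ≤ 2 * x ^ (n + 1) * g (n + 1) (x / 2) := by
        gcongr
        linarith
      _ = 2 ^ (n + 2) * ((x / 2) ^ (n + 1) * g (n + 1) (x / 2)) := by
        rw [div_pow]
        field_simp
        ring

end AltDerivChain

/-- The Taylor polynomial of `g 0` of degree `n` about `x`, evaluated at `0`, for an alternating
chain of derivatives `g`. -/
noncomputable def taylorAtZero (g : ℕ → ℝ → ℝ) (n : ℕ) (x : ℝ) : ℝ :=
  ∑ j ∈ Finset.range (n + 1), x ^ j * g j x / (j.factorial : ℝ)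

theorem taylorAtZero_succ (g : ℕ → ℝ → ℝ) (n : ℕ) (x : ℝ) :
    taylorAtZero g (n + 1) x =
      taylorAtZero g n x + x ^ (n + 1) * g (n + 1) x / ((n + 1).factorial : ℝ) :=
  Finset.sum_range_succ _ _

theorem taylorAtZero_zero (g : ℕ → ℝ → ℝ) (x : ℝ) : taylorAtZero g 0 x = g 0 x := by
  simp [taylorAtZero]

namespace AltDerivChain

variable {m n : ℕ} {g : ℕ → ℝ → ℝ}

theorem hasDerivAt_taylorAtZero (hg : AltDerivChain m g) (hn : n < m) {x : ℝ} (hx : 0 < x) :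
    HasDerivAt (taylorAtZero g n) (-(x ^ n * g (n + 1) x / (n.factorial : ℝ))) x := by
  induction n with
  | zero =>
    have : taylorAtZero g 0 = g 0 := funext (taylorAtZero_zero g)
    simpa [this] using hg 0 hn x hx
  | succ n ih =>
    have : taylorAtZero g (n + 1) = fun x => taylorAtZero g n x +
        x ^ (n + 1) * g (n + 1) x / ((n + 1).factorial : ℝ) := funext (taylorAtZero_succ g n)
    rw [this]
    have hterm := ((hasDerivAt_pow (n + 1) x).mul (hg (n + 1) hn x hx)).div_const
      ((n + 1).factorial : ℝ)
    refine ((ih (by omega)).add hterm).congr_deriv ?_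
    rw [Nat.factorial_succ]
    push_cast
    field_simp
    ring

theorem tendsto_taylorAtZero (hg : AltDerivChain m g)
    (hc : ∀ j ≤ m, NonnegAntitoneConvex (g j)) {L : ℝ}
    (h0 : Tendsto (g 0) (nhdsWithin 0 (Ioi 0)) (nhds L)) (hn : n ≤ m) :
    Tendsto (taylorAtZero g n) (nhdsWithin 0 (Ioi 0)) (nhds L) := by
  induction n with
  | zero => simpa only [funext (taylorAtZero_zero g)] using h0
  | succ n ih =>
    have := (ih (by omega)).add
      ((hg.tendsto_pow_mul_zero hc h0 hn).div_const ((n + 1).factorial : ℝ))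
    simpa only [funext (taylorAtZero_succ g n), zero_div, add_zero] using this

theorem integral_dilation_eq (hg : AltDerivChain m g) (hn : n < m)
    (hc : NonnegAntitoneConvex (g (n + 1))) {ε x : ℝ} (hε : 0 < ε) (hε1 : ε ≤ 1) (hx : 0 < x) :
    ∫ t in ε..1, t ^ n * g (n + 1) (t * x) =
      n.factorial * (x ^ (n + 1))⁻¹ * (taylorAtZero g n (ε * x) - taylorAtZero g n x) := by
  have hd : ∀ t ∈ uIcc ε 1, HasDerivAt
      (fun t => -(n.factorial * (x ^ (n + 1))⁻¹) * taylorAtZero g n (t * x))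
      (t ^ n * g (n + 1) (t * x)) t := fun t ht => by
    rw [uIcc_of_le hε1] at ht
    have ht0 : 0 < t := hε.trans_le ht.1
    have hcomp := (hg.hasDerivAt_taylorAtZero hn (mul_pos ht0 hx)).comp t
      ((hasDerivAt_id t).mul_const x)
    refine (hcomp.const_mul (-(n.factorial * (x ^ (n + 1))⁻¹))).congr_deriv ?_
    have : (n.factorial : ℝ) ≠ 0 := by positivity
    field_simp
    ring
  rw [intervalIntegral.integral_eq_sub_of_hasDerivAt hd
    (hc.intervalIntegrable_dilation n hε hε1 hx), one_mul]
  ring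

theorem nonnegAntitoneConvex_taylor_remainder (hg : AltDerivChain m g)
    (hc : ∀ j ≤ m, NonnegAntitoneConvex (g j)) {L : ℝ}
    (h0 : Tendsto (g 0) (nhdsWithin 0 (Ioi 0)) (nhds L)) (hL : L ≤ 1) (hn : n < m) :
    NonnegAntitoneConvex
      (fun x => n.factorial * (x ^ (n + 1))⁻¹ * (1 - taylorAtZero g n x)) := by
  have hpart : NonnegAntitoneConvex
      (fun x => n.factorial * (x ^ (n + 1))⁻¹ * (L - taylorAtZero g n x)) := by
    have hev : ∀ᶠ ε in nhdsWithin (0 : ℝ) (Ioi 0), 0 < ε ∧ ε ≤ 1 := by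
      filter_upwards [self_mem_nhdsWithin, mem_nhdsWithin_of_mem_nhds (Iic_mem_nhds one_pos)]
        with ε h1 h2 using ⟨h1, h2⟩
    refine .of_tendsto (l := nhdsWithin (0 : ℝ) (Ioi 0))
      (F := fun ε x => ∫ t in ε..1, t ^ n * g (n + 1) (t * x))
      (hev.mono fun ε hε => (hc (n + 1) hn).integral_dilation n hε.1 hε.2) fun x hx => ?_
    have hx0 : 0 < x := hx
    have hscale : Tendsto (fun ε : ℝ => ε * x) (nhdsWithin 0 (Ioi 0)) (nhdsWithin 0 (Ioi 0)) := by
      refine tendsto_nhdsWithin_iff.2 ⟨?_, ?_⟩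
      · have : Tendsto (fun ε : ℝ => ε * x) (nhds 0) (nhds (0 * x)) :=
          (continuous_id.mul continuous_const).tendsto 0
        exact (by simpa using this : Tendsto (fun ε : ℝ => ε * x) (nhds 0) (nhds 0)).mono_left
          nhdsWithin_le_nhds
      · filter_upwards [self_mem_nhdsWithin] with ε hε using mul_pos hε hx0
    have hlim := (((hg.tendsto_taylorAtZero hc h0 hn.le).comp hscale).sub_const
      (taylorAtZero g n x)).const_mul (n.factorial * (x ^ (n + 1))⁻¹)
    refine hlim.congr' (hev.mono fun ε hε => ?_)
    exact (hg.integral_dilation_eq hn (hc (n + 1) hn) hε.1 hε.2 hx).symm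
  have hpole : NonnegAntitoneConvex
      (fun x => ((1 - L) * n.factorial) * (x ^ (n + 1))⁻¹) :=
    .const_mul (mul_nonneg (sub_nonneg.2 hL) (by positivity)) (.inv_pow (n + 1))
  refine (hpole.add hpart).congr fun x _ => ?_
  ring

theorem iteratedDerivWithin_eq (hg : AltDerivChain m g) (hn : n ≤ m) {x : ℝ} (hx : 0 < x) :
    iteratedDerivWithin n (fun x => (1 - g 0 x) / x) (Ioi 0) x =
      (-1) ^ n * (n.factorial * (x ^ (n + 1))⁻¹ * (1 - taylorAtZero g n x)) := by
  induction n generalizing x with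
  | zero => simp [taylorAtZero_zero, div_eq_inv_mul]
  | succ n ih =>
    have hcongr : EqOn (iteratedDerivWithin n (fun x => (1 - g 0 x) / x) (Ioi 0)) _ (Ioi 0) :=
      fun y hy => ih (by omega) hy
    rw [iteratedDerivWithin_succ, derivWithin_congr hcongr (hcongr hx)]
    have hinv := (hasDerivAt_pow (n + 1) x).inv (pow_ne_zero _ hx.ne')
    have hd := (((hinv.const_mul (n.factorial : ℝ)).mul
      ((hg.hasDerivAt_taylorAtZero hn hx).const_sub 1)).const_mul ((-1 : ℝ) ^ n))
    refine (hd.hasDerivWithinAt.derivWithin (uniqueDiffOn_Ioi 0 x hx)).trans ?_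
    rw [taylorAtZero_succ, Nat.factorial_succ]
    have : (n.factorial : ℝ) ≠ 0 := by positivity
    push_cast
    simp only [Pi.inv_apply]
    field_simp
    ring

end AltDerivChain

/-- If `h ∈ M_{m+1}` and the finite limit `h(+0) ≤ 1` exists, then
`λ(x) = (1 - h x)/x ∈ M_k` for all `k = 1, …, m`. -/
theorem lambda_mem_M
    (m : ℕ) (hm : 0 < m) (h : ℝ → ℝ) (hM : MemM (m + 1) h)
    (h0 : ∃ L : ℝ, Tendsto h (nhdsWithin 0 (Ioi 0)) (nhds L) ∧ L ≤ 1) :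
    ∀ k : ℕ, 1 ≤ k → k ≤ m → MemM k (fun x => (1 - h x) / x) := by
  intro k hk hkm
  obtain ⟨n, rfl⟩ : ∃ n, k = n + 1 := ⟨k - 1, by omega⟩
  obtain ⟨hdiff, hnonneg, hanti, hconv, A, hA, hAlim⟩ := hM
  obtain ⟨L, hL, hL1⟩ := h0
  simp only [Nat.add_sub_cancel] at hdiff hnonneg hanti hconv
  have hg := altDerivChain_iteratedDerivWithin hdiff
  have hg0 : (fun x => (-1 : ℝ) ^ 0 * iteratedDerivWithin 0 h (Ioi 0) x) = h := by
    ext x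
    simp
  have hc := fun j (hj : j ≤ m) =>
    hg.nonnegAntitoneConvex ⟨hnonneg, hanti, hconv⟩ hA (by rwa [hg0]) hj
  have hrem := hg.nonnegAntitoneConvex_taylor_remainder hc (by rwa [hg0]) hL1 hkm
  have hder : NonnegAntitoneConvex (fun x => (-1 : ℝ) ^ n *
      iteratedDerivWithin n (fun x => (1 - h x) / x) (Ioi 0) x) := by
    refine hrem.congr fun x hx => ?_
    have := hg.iteratedDerivWithin_eq (n := n) (by omega) hx
    simp only [pow_zero, one_mul, iteratedDerivWithin_zero] at this
    simp only [this]
    rw [← mul_assoc, ← mul_pow]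
    simp
  refine ⟨?_, hder.nonneg, hder.antitone, hder.convex, 0, le_rfl, ?_⟩
  · refine (contDiffOn_const.sub (hdiff.of_le ?_)).div contDiffOn_id fun x hx => ne_of_gt hx
    exact_mod_cast (by omega : n + 1 - 1 ≤ m)
  · exact (hAlim.const_sub 1).div_atTop tendsto_id
end
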